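/- arXiv:2511.22953 — 4 statements merged into one kernel-verified Lean document; each statement's English description precedes it below -/
import Mathlib

section
/- Let H_1,…,H_m be graphs with pairwise disjoint vertex sets, with fixed roots x_i ∈ V(H_i), and assume condition (*) (m ≥ 2, every H_i is connected, and the rooted products considered are nonempty graphs). Then the following are equivalent: (1) H_i is 2-pure with respect to x_i for every i; (2) the rooted product G_0(ℋ) is well-covered for every graph G_0 on the vertex set X_[m] = {x_1,…,x_m}. -/
open Classical

variable {V : Type*}

/-- `A` is an independent set of the graph `G`. -/
def SimpleGraph.IsIndepSet' (G : SimpleGraph V) (A : Set V) : Prop :=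
  A.Pairwise fun u v => ¬ G.Adj u v

/-- `A` is a maximal independent set of the induced subgraph of `G` on `s`. -/
def SimpleGraph.IsMaxIndepOn (G : SimpleGraph V) (s A : Set V) : Prop :=
  A ⊆ s ∧ G.IsIndepSet' A ∧ ∀ B ⊆ s, G.IsIndepSet' B → A ⊆ B → A = B

/-- The independence number of the induced subgraph of `G` on `s`. -/
noncomputable def SimpleGraph.alphaOn (G : SimpleGraph V) (s : Set V) : ℕ :=
  sSup {n : ℕ | ∃ A ⊆ s, G.IsIndepSet' A ∧ A.ncard = n}

/-- The induced subgraph of `G` on `s` is well-covered: every maximal independent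
set has cardinality equal to the independence number. -/
def SimpleGraph.WellCoveredOn (G : SimpleGraph V) (s : Set V) : Prop :=
  ∀ A : Set V, G.IsMaxIndepOn s A → A.ncard = G.alphaOn s

/-- `G` is well-covered. -/
def SimpleGraph.WellCovered (G : SimpleGraph V) : Prop :=
  G.WellCoveredOn Set.univ

/-- `G` is 2-pure with respect to the vertex `x`:  `G` is well-covered, `G - x` is
well-covered, and `α(G - x) = α(G)`. -/
def SimpleGraph.TwoPureAt (G : SimpleGraph V) (x : V) : Prop :=
  G.WellCovered ∧ G.WellCoveredOn {x}ᶜ ∧ G.alphaOn {x}ᶜ = G.alphaOn Set.univ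


/-- The rooted product `G₀(ℋ)` of the graph `G₀` on `{x_1, …, x_m}` by the family of
graphs `H i` with roots `x i`: the vertex set is the disjoint union of the `V(H i)`
and the edges are those of all the `H i` together with the edges of `G₀` placed on
the roots. -/
def rootedProduct {m : ℕ} {W : Fin m → Type*} (G0 : SimpleGraph (Fin m))
    (H : ∀ i, SimpleGraph (W i)) (x : ∀ i, W i) : SimpleGraph (Σ i, W i) :=
  SimpleGraph.fromRel fun a b =>
    (∃ h : a.1 = b.1, (H b.1).Adj (h ▸ a.2) b.2) ∨
      (G0.Adj a.1 b.1 ∧ a.2 = x a.1 ∧ b.2 = x b.1)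

/-- Condition (*) for a given base graph `G₀`:  `m ≥ 2`, every `H i` is connected and
the rooted product `G₀(ℋ)` has at least one edge. -/
def ConditionStarOn {m : ℕ} {W : Fin m → Type*} (G0 : SimpleGraph (Fin m))
    (H : ∀ i, SimpleGraph (W i)) (x : ∀ i, W i) : Prop :=
  2 ≤ m ∧ (∀ i, (H i).Connected) ∧ ∃ a b, (rootedProduct G0 H x).Adj a b

theorem maxIff (G : SimpleGraph V) (s A : Set V) :
    G.IsMaxIndepOn s A ↔ A ⊆ s ∧ G.IsIndepSet' A ∧ ∀ v ∈ s, v ∉ A → ∃ u ∈ A, G.Adj v u := by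
  constructor
  · rintro ⟨h1, h2, h3⟩
    refine ⟨h1, h2, fun v hv hvA => ?_⟩
    by_contra hcon
    push Not at hcon
    have := h3 (insert v A) (Set.insert_subset hv h1) ?_ (Set.subset_insert _ _)
    · exact hvA (this ▸ Set.mem_insert v A)
    · intro a ha b hb hab hadj
      rcases ha with rfl | ha <;> rcases hb with rfl | hb
      · exact hab rfl
      · exact hcon _ hb hadj
      · exact hcon _ ha hadj.symm
      · exact h2 ha hb hab hadj
  · rintro ⟨h1, h2, h3⟩
    refine ⟨h1, h2, fun B hB hBi hAB => ?_⟩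
    apply Set.Subset.antisymm hAB
    intro v hv
    by_contra hvA
    obtain ⟨u, hu, ha⟩ := h3 v (hB hv) hvA
    exact hBi hv (hAB hu) ha.ne ha

theorem extMax [Finite V] (G : SimpleGraph V) (s B : Set V) (hB : B ⊆ s)
    (hi : G.IsIndepSet' B) : ∃ A, B ⊆ A ∧ G.IsMaxIndepOn s A := by
  have hf : {A : Set V | A ⊆ s ∧ G.IsIndepSet' A}.Finite := Set.toFinite _
  obtain ⟨A, hBA, hA⟩ := hf.exists_le_maximal (a := B) ⟨hB, hi⟩
  exact ⟨A, hBA, hA.1.1, hA.1.2, fun C hC hCi hAC =>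
    Set.Subset.antisymm hAC (hA.2 ⟨hC, hCi⟩ hAC)⟩

theorem alphaMax [Finite V] (G : SimpleGraph V) (s : Set V) :
    ∃ A, G.IsMaxIndepOn s A ∧ A.ncard = G.alphaOn s := by
  have hbd : BddAbove {n : ℕ | ∃ A ⊆ s, G.IsIndepSet' A ∧ A.ncard = n} := by
    refine ⟨Nat.card V, ?_⟩
    rintro n ⟨A, -, -, rfl⟩
    rw [← Set.ncard_univ]
    exact Set.ncard_le_ncard (Set.subset_univ _) (Set.toFinite _)
  have hne : {n : ℕ | ∃ A ⊆ s, G.IsIndepSet' A ∧ A.ncard = n}.Nonempty :=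
    ⟨_, ∅, Set.empty_subset _, by simp [SimpleGraph.IsIndepSet'], rfl⟩
  obtain ⟨A, hA, hAi, hc⟩ := Nat.sSup_mem hne hbd
  obtain ⟨B, hAB, hB⟩ := extMax G s A hA hAi
  refine ⟨B, hB, le_antisymm (le_csSup hbd ⟨B, hB.1, hB.2.1, rfl⟩) ?_⟩
  unfold SimpleGraph.alphaOn
  rw [← hc]
  exact Set.ncard_le_ncard hAB (Set.toFinite _)

theorem wcOf [Finite V] (G : SimpleGraph V) (s : Set V) (n : ℕ)
    (h : ∀ A, G.IsMaxIndepOn s A → A.ncard = n) : G.WellCoveredOn s ∧ G.alphaOn s = n := by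
  obtain ⟨A, hA, hc⟩ := alphaMax G s
  have := h A hA
  exact ⟨fun B hB => by rw [h B hB]; omega, by omega⟩

theorem extVert [Finite V] (G : SimpleGraph V) (v : V) :
    ∃ A, v ∈ A ∧ G.IsMaxIndepOn Set.univ A := by
  obtain ⟨A, h, hA⟩ := extMax G Set.univ {v} (Set.subset_univ _)
    (by simp [SimpleGraph.IsIndepSet'])
  exact ⟨A, h rfl, hA⟩

section
variable {m : ℕ} {W : Fin m → Type*} (G0 : SimpleGraph (Fin m))
    (H : ∀ i, SimpleGraph (W i)) (x : ∀ i, W i)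

theorem rp_same (i : Fin m) (a b : W i) :
    (rootedProduct G0 H x).Adj ⟨i, a⟩ ⟨i, b⟩ ↔ (H i).Adj a b := by
  rw [rootedProduct, SimpleGraph.fromRel_adj]
  constructor
  · rintro ⟨-, (⟨_, h⟩ | ⟨h, -⟩) | (⟨_, h⟩ | ⟨h, -⟩)⟩
    · exact h
    · exact absurd h (SimpleGraph.irrefl _)
    · exact h.symm
    · exact absurd h (SimpleGraph.irrefl _)
  · intro h
    refine ⟨?_, Or.inl (Or.inl ⟨rfl, h⟩)⟩
    intro e
    exact h.ne (by simpa using e)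

theorem rp_diff (i j : Fin m) (hij : i ≠ j) (a : W i) (b : W j) :
    (rootedProduct G0 H x).Adj ⟨i, a⟩ ⟨j, b⟩ ↔ G0.Adj i j ∧ a = x i ∧ b = x j := by
  rw [rootedProduct, SimpleGraph.fromRel_adj]
  constructor
  · rintro ⟨-, (⟨h, -⟩ | h) | (⟨h, -⟩ | ⟨h1, h2, h3⟩)⟩
    · exact absurd h hij
    · exact h
    · exact absurd h.symm hij
    · exact ⟨h1.symm, h3, h2⟩
  · intro h
    refine ⟨?_, Or.inl (Or.inr h)⟩
    intro e
    exact hij (congrArg Sigma.fst e)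

theorem glue (S : ∀ i, Set (W i)) (h1 : ∀ i, (H i).IsIndepSet' (S i))
    (h2 : ∀ i j, G0.Adj i j → x i ∈ S i → x j ∈ S j → False)
    (h3 : ∀ i, ∀ v ∉ S i, (∃ u ∈ S i, (H i).Adj v u) ∨
      (v = x i ∧ ∃ j, G0.Adj i j ∧ x j ∈ S j)) :
    (rootedProduct G0 H x).IsMaxIndepOn Set.univ {p | p.2 ∈ S p.1} := by
  rw [maxIff]
  refine ⟨Set.subset_univ _, ?_, ?_⟩
  · rintro ⟨i, a⟩ ha ⟨j, b⟩ hb hab hadj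
    by_cases hij : i = j
    · subst hij
      rw [rp_same] at hadj
      exact h1 i ha hb hadj.ne hadj
    · rw [rp_diff _ _ _ _ _ hij] at hadj
      obtain ⟨h, rfl, rfl⟩ := hadj
      exact h2 i j h ha hb
  · rintro ⟨i, v⟩ - hv
    rcases h3 i v hv with ⟨u, hu, h⟩ | ⟨rfl, j, hj, hx⟩
    · exact ⟨⟨i, u⟩, hu, (rp_same _ _ _ _ _ _).2 h⟩
    · exact ⟨⟨j, x j⟩, hx, (rp_diff _ _ _ _ _ hj.ne _ _).2 ⟨hj, rfl, rfl⟩⟩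

theorem ncardSigma [∀ i, Fintype (W i)] (A : Set (Σ i, W i)) :
    A.ncard = ∑ i, (Sigma.mk i ⁻¹' A).ncard := by
  have : A.toFinset = Finset.univ.sigma fun i => (Sigma.mk i ⁻¹' A).toFinset := by
    ext ⟨i, a⟩
    simp
  rw [Set.ncard_eq_toFinset_card', this, Finset.card_sigma]
  exact Finset.sum_congr rfl fun i _ => (Set.ncard_eq_toFinset_card' _).symm

theorem slice (A : Set (Σ i, W i)) (hA : (rootedProduct G0 H x).IsMaxIndepOn Set.univ A)
    (i : Fin m) : (H i).IsMaxIndepOn Set.univ (Sigma.mk i ⁻¹' A) ∨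
      (H i).IsMaxIndepOn {x i}ᶜ (Sigma.mk i ⁻¹' A) := by
  rw [maxIff] at hA
  obtain ⟨-, hi, hm⟩ := hA
  have hI : (H i).IsIndepSet' (Sigma.mk i ⁻¹' A) := by
    intro a ha b hb hab h
    have h' := (rp_same G0 H x i a b).2 h
    exact hi ha hb h'.ne h'
  have key : ∀ v, v ∉ (Sigma.mk i ⁻¹' A) → v ≠ x i →
      ∃ u ∈ (Sigma.mk i ⁻¹' A), (H i).Adj v u := by
    intro v hv hvx
    obtain ⟨⟨j, u⟩, hu, h⟩ := hm ⟨i, v⟩ trivial hv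
    by_cases hij : i = j
    · subst hij
      exact ⟨u, hu, (rp_same _ _ _ _ _ _).1 h⟩
    · exact absurd ((rp_diff _ _ _ _ _ hij _ _).1 h).2.1 hvx
  rw [maxIff, maxIff]
  by_cases hx : x i ∈ (Sigma.mk i ⁻¹' A) ∨ ∃ u ∈ (Sigma.mk i ⁻¹' A), (H i).Adj (x i) u
  · left
    refine ⟨Set.subset_univ _, hI, fun v _ hv => ?_⟩
    by_cases hvx : v = x i
    · subst hvx
      exact hx.resolve_left hv
    · exact key v hv hvx
  · right
    push Not at hx
    refine ⟨?_, hI, fun v hvx hv => key v hv hvx⟩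
    rintro v hv rfl
    exact hx.1 hv
end

theorem stmt2 {m : ℕ} {W : Fin m → Type*} [∀ i, Fintype (W i)] [∀ i, DecidableEq (W i)]
    (H : ∀ i, SimpleGraph (W i)) (x : ∀ i, W i)
    (hstar : ∀ G0 : SimpleGraph (Fin m), ConditionStarOn G0 H x) :
    (∀ i, (H i).TwoPureAt (x i)) ↔
      (∀ G0 : SimpleGraph (Fin m), (rootedProduct G0 H x).WellCovered) := by
  constructor
  · intro h G0
    refine (wcOf _ _ (∑ i, (H i).alphaOn Set.univ) fun A hA => ?_).1
    rw [ncardSigma]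
    refine Finset.sum_congr rfl fun i _ => ?_
    obtain ⟨h1, h2, h3⟩ := h i
    rcases slice G0 H x A hA i with h' | h'
    · exact h1 _ h'
    · rw [h2 _ h', h3]
  · intro h
    have pre : ∀ S : ∀ i, Set (W i), ∀ i,
        Sigma.mk i ⁻¹' {p : Σ i, W i | p.2 ∈ S p.1} = S i := fun S i => rfl
    have eqs : ∀ G0 : SimpleGraph (Fin m), ∀ S T : ∀ i, Set (W i),
        (rootedProduct G0 H x).IsMaxIndepOn Set.univ {p | p.2 ∈ S p.1} →
        (rootedProduct G0 H x).IsMaxIndepOn Set.univ {p | p.2 ∈ T p.1} →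
        ∑ i, (S i).ncard = ∑ i, (T i).ncard := by
      intro G0 S T hS hT
      have h1 := h G0 _ hS
      have h2 := h G0 _ hT
      rw [ncardSigma] at h1 h2
      simp only [pre] at h1 h2
      omega
    have wc : ∀ i, (H i).WellCovered := by
      intro i
      choose M hM hMc using fun l => alphaMax (H l) Set.univ
      refine (wcOf _ _ (M i).ncard fun A hA => ?_).1
      have : ∀ l, ∃ S, (H l).IsMaxIndepOn Set.univ S ∧
          (∀ e : l = i, S = e ▸ A) ∧ (l ≠ i → S = M l) := by
        intro l
        by_cases e : l = i
        · subst e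
          exact ⟨A, hA, fun _ => rfl, fun h => absurd rfl h⟩
        · exact ⟨M l, hM l, fun h => absurd h e, fun _ => rfl⟩
      choose S hS hSi hSl using this
      have gl : ∀ S : ∀ l, Set (W l), (∀ l, (H l).IsMaxIndepOn Set.univ (S l)) →
          (rootedProduct ⊥ H x).IsMaxIndepOn Set.univ {p | p.2 ∈ S p.1} := by
        intro S hS
        refine glue _ _ _ _ (fun l => (hS l).2.1) (fun i j hh => by simp at hh) ?_
        intro l v hv
        exact Or.inl (((maxIff _ _ _).1 (hS l)).2.2 v trivial hv)
      have e := eqs ⊥ S M (gl S hS) (gl M hM)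
      rw [← Finset.add_sum_erase _ _ (Finset.mem_univ i),
        ← Finset.add_sum_erase _ (fun i => (M i).ncard) (Finset.mem_univ i)] at e
      have e2 : ∑ l ∈ Finset.univ.erase i, (S l).ncard =
          ∑ l ∈ Finset.univ.erase i, (M l).ncard :=
        Finset.sum_congr rfl fun l hl => by rw [hSl l (Finset.ne_of_mem_erase hl)]
      have e3 : S i = A := hSi i rfl
      rw [e2, e3] at e
      exact Nat.add_right_cancel e
    -- a nontrivial factor
    obtain ⟨hm, hconn, ⟨j, a⟩, ⟨j', b⟩, hab⟩ := hstar ⊥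
    have hjj : j = j' := by
      by_contra hne
      rw [rp_diff _ _ _ _ _ hne] at hab
      simp at hab
    subst hjj
    rw [rp_same] at hab
    have hnt : Nontrivial (W j) := ⟨a, b, hab.ne⟩
    obtain ⟨y, hy⟩ := (hconn j).preconnected.exists_adj_of_nontrivial (x j)
    intro i
    refine ⟨wc i, ?_⟩
    apply wcOf
    intro A hA
    have hA' := (maxIff _ _ _).1 hA
    obtain ⟨hAs, hAi, hAm⟩ := hA'
    have hxA : x i ∉ A := fun hx => hAs hx rfl
    by_cases hx : ∃ u ∈ A, (H i).Adj (x i) u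
    · apply wc i
      rw [maxIff]
      refine ⟨Set.subset_univ _, hAi, fun v _ hv => ?_⟩
      by_cases hvx : v = x i
      · rw [hvx]; exact hx
      · exact hAm v hvx hv
    · exfalso
      push Not at hx
      have hins : (H i).IsMaxIndepOn Set.univ (insert (x i) A) := by
        rw [maxIff]
        refine ⟨Set.subset_univ _, ?_, ?_⟩
        · intro a ha b hb hab hadj
          rcases ha with rfl | ha <;> rcases hb with rfl | hb
          · exact hab rfl
          · exact hx _ hb hadj
          · exact hx _ ha hadj.symm
          · exact hAi ha hb hab hadj
        · intro v _ hv
          rw [Set.mem_insert_iff, not_or] at hv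
          obtain ⟨u, hu, hh⟩ := hAm v hv.1 hv.2
          exact ⟨u, Or.inr hu, hh⟩
      have hcard := wc i _ hins
      rw [Set.ncard_insert_of_notMem hxA (Set.toFinite _)] at hcard
      have hk : ∃ k, i ≠ k ∧ (j = i ∨ j = k) := by
        by_cases hji : j = i
        · have : Nontrivial (Fin m) := Fin.nontrivial_iff_two_le.2 hm
          obtain ⟨k, hk⟩ := exists_ne i
          exact ⟨k, hk.symm, Or.inl hji⟩
        · exact ⟨j, fun e => hji e.symm, Or.inr rfl⟩
      obtain ⟨k, hik, hjk⟩ := hk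
      have hT : ∀ l, ∃ T, (H l).IsMaxIndepOn Set.univ T ∧ (l = j → x l ∉ T) := by
        intro l
        by_cases e : l = j
        · subst e
          obtain ⟨T, hyT, hT⟩ := extVert (H l) y
          exact ⟨T, hT, fun _ hxT => hT.2.1 hxT hyT hy.ne hy⟩
        · obtain ⟨T, -, hT⟩ := extVert (H l) (x l)
          exact ⟨T, hT, fun h => absurd h e⟩
      choose T hT hTj using hT
      have hS : ∀ l, ∃ S, (∀ e : l = i, S = e ▸ A) ∧
          (l ≠ i → x l ∈ S ∧ (H l).IsMaxIndepOn Set.univ S) := by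
        intro l
        by_cases e : l = i
        · subst e
          exact ⟨A, fun _ => rfl, fun h => absurd rfl h⟩
        · obtain ⟨S, hS⟩ := extVert (H l) (x l)
          exact ⟨S, fun h => absurd h e, fun _ => hS⟩
      choose S hSi hSl using hS
      have hSA : S i = A := hSi i rfl
      have gT := glue (SimpleGraph.edge i k) H x T (fun l => (hT l).2.1) (by
          intro p q hpq hp hq
          have hpj : p ≠ j := fun e => hTj p e hp
          have hqj : q ≠ j := fun e => hTj q e hq
          rw [SimpleGraph.edge_adj] at hpq
          grind)
        (fun l v hv => Or.inl (((maxIff _ _ _).1 (hT l)).2.2 v trivial hv))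
      have gS := glue (SimpleGraph.edge i k) H x S (by
          intro l
          by_cases e : l = i
          · subst e; rw [hSA]; exact hAi
          · exact (hSl l e).2.2.1) (by
          intro p q hpq hp hq
          have hpj : p ≠ i := by rintro rfl; rw [hSA] at hp; exact hxA hp
          have hqj : q ≠ i := by rintro rfl; rw [hSA] at hq; exact hxA hq
          rw [SimpleGraph.edge_adj] at hpq
          grind) (by
          intro l v hv
          by_cases e : l = i
          · subst e
            by_cases hvx : v = x l
            · exact Or.inr ⟨hvx, k, by rw [SimpleGraph.edge_adj]; exact ⟨Or.inl ⟨rfl, rfl⟩, hik⟩,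
                (hSl k hik.symm).1⟩
            · left
              rw [hSA] at hv ⊢
              exact hAm v hvx hv
          · exact Or.inl (((maxIff _ _ _).1 (hSl l e).2).2.2 v trivial hv))
      have e := eqs _ S T gS gT
      have lt : ∑ l, (S l).ncard < ∑ l, (T l).ncard := by
        apply Finset.sum_lt_sum
        · intro l _
          rw [wc l _ (hT l)]
          by_cases e : l = i
          · subst e; rw [hSA]; omega
          · rw [wc l _ (hSl l e).2]
        · refine ⟨i, Finset.mem_univ i, ?_⟩
          rw [hSA, wc i _ (hT i)]
          omega
      omega
end

section
/- Let H_1,…,H_m be graphs with pairwise disjoint vertex sets, with fixed roots x_i ∈ V(H_i), assume condition (*) and additionally that |V(H_i)| ≥ 2 for all i. Let 𝒢 be a family of graphs on X_[m] = {x_1,…,x_m} such that for every i there exists G ∈ 𝒢 in which x_i is not an isolated vertex. Then the following are equivalent: (1) H_i is 2-pure with respect to x_i for every i; (2) the rooted product G(ℋ) is well-covered for every graph G ∈ 𝒢. -/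
open Classical

variable {V : Type*}

theorem maxIndep_iff {V : Type*} (G : SimpleGraph V) (s A : Set V) :
    G.IsMaxIndepOn s A ↔ A ⊆ s ∧ (∀ u ∈ A, ∀ v ∈ A, ¬ G.Adj u v) ∧
      ∀ y ∈ s, y ∉ A → ∃ a ∈ A, G.Adj y a := by
  constructor
  · rintro ⟨h1, h2, h3⟩
    refine ⟨h1, fun u hu v hv huv => h2 hu hv huv.ne huv, fun y hy hyA => ?_⟩
    by_contra! hc
    have := h3 (insert y A) (Set.insert_subset hy h1) ?_ (Set.subset_insert _ _)
    · exact hyA (this ▸ Set.mem_insert y A)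
    · rintro u (rfl | hu) v (rfl | hv) huv
      · exact absurd rfl huv
      · exact hc v hv
      · exact fun h => hc u hu h.symm
      · exact h2 hu hv huv
  · rintro ⟨h1, h2, h3⟩
    refine ⟨h1, fun u hu v hv _ => h2 u hu v hv, fun B hB hBi hAB => ?_⟩
    refine Set.Subset.antisymm hAB fun y hy => ?_
    by_contra hyA
    obtain ⟨a, ha, hya⟩ := h3 y (hB hy) hyA
    exact hBi hy (hAB ha) hya.ne hya

theorem exists_max_of_indep {V : Type*} [Finite V] (G : SimpleGraph V) (s A : Set V)
    (hA : A ⊆ s) (hi : G.IsIndepSet' A) : ∃ B, G.IsMaxIndepOn s B ∧ A ⊆ B := by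
  obtain ⟨B, hAB, hB⟩ := Set.Finite.exists_le_maximal
    (Set.toFinite {B : Set V | B ⊆ s ∧ G.IsIndepSet' B}) (a := A) ⟨hA, hi⟩
  refine ⟨B, ⟨hB.prop.1, hB.prop.2, fun C hC hCi hBC => ?_⟩, hAB⟩
  exact Set.Subset.antisymm hBC (hB.le_of_ge ⟨hC, hCi⟩ hBC)

theorem alpha_attained {V : Type*} [Finite V] (G : SimpleGraph V) (s : Set V) :
    ∃ A, G.IsMaxIndepOn s A ∧ A.ncard = G.alphaOn s := by
  have hbdd : BddAbove {n : ℕ | ∃ A ⊆ s, G.IsIndepSet' A ∧ A.ncard = n} := by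
    refine ⟨(Set.univ : Set V).ncard, ?_⟩
    rintro n ⟨A, -, -, rfl⟩
    exact Set.ncard_le_ncard (Set.subset_univ A)
  have hne : {n : ℕ | ∃ A ⊆ s, G.IsIndepSet' A ∧ A.ncard = n}.Nonempty :=
    ⟨_, ∅, Set.empty_subset _, Set.pairwise_empty _, rfl⟩
  obtain ⟨A, hA, hi, hn⟩ := Nat.sSup_mem hne hbdd
  obtain ⟨B, hB, hAB⟩ := exists_max_of_indep G s A hA hi
  refine ⟨B, hB, le_antisymm (le_csSup hbdd ⟨B, hB.1, hB.2.1, rfl⟩) ?_⟩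
  unfold SimpleGraph.alphaOn
  rw [← hn]
  exact Set.ncard_le_ncard hAB

theorem wc_of_const {V : Type*} [Finite V] (G : SimpleGraph V) (s : Set V) (c : ℕ)
    (h : ∀ A, G.IsMaxIndepOn s A → A.ncard = c) : G.WellCoveredOn s ∧ G.alphaOn s = c := by
  obtain ⟨A, hA, hn⟩ := alpha_attained G s
  have : G.alphaOn s = c := hn ▸ h A hA
  exact ⟨fun B hB => by rw [this, h B hB], this⟩

theorem rp_adj_same {m : ℕ} {W : Fin m → Type*} (G : SimpleGraph (Fin m))
    (H : ∀ i, SimpleGraph (W i)) (x : ∀ i, W i) (k : Fin m) (a b : W k) :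
    (rootedProduct G H x).Adj ⟨k, a⟩ ⟨k, b⟩ ↔ (H k).Adj a b := by
  simp only [rootedProduct, SimpleGraph.fromRel_adj]
  constructor
  · rintro ⟨-, (⟨_, h⟩ | h) | (⟨_, h⟩ | h)⟩
    · exact h
    · exact absurd h.1 (G.loopless.irrefl k)
    · exact h.symm
    · exact absurd h.1 (G.loopless.irrefl k)
  · intro h
    refine ⟨fun e => h.ne (by simpa using e), by simp [h]⟩

theorem rp_adj_diff {m : ℕ} {W : Fin m → Type*} (G : SimpleGraph (Fin m))
    (H : ∀ i, SimpleGraph (W i)) (x : ∀ i, W i) (k l : Fin m) (hkl : k ≠ l)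
    (a : W k) (b : W l) :
    (rootedProduct G H x).Adj ⟨k, a⟩ ⟨l, b⟩ ↔ G.Adj k l ∧ a = x k ∧ b = x l := by
  simp only [rootedProduct, SimpleGraph.fromRel_adj]
  constructor
  · rintro ⟨-, (⟨e, h⟩ | h) | (⟨e, h⟩ | h)⟩
    · exact absurd e hkl
    · exact h
    · exact absurd e.symm hkl
    · exact ⟨h.1.symm, h.2.2, h.2.1⟩
  · intro h
    refine ⟨fun e => hkl (congrArg Sigma.fst e), Or.inl (Or.inr h)⟩

theorem rp_max {m : ℕ} {W : Fin m → Type*} (G : SimpleGraph (Fin m))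
    (H : ∀ i, SimpleGraph (W i)) (x : ∀ i, W i) (F : ∀ i, Set (W i)) :
    (rootedProduct G H x).IsMaxIndepOn Set.univ {p | p.2 ∈ F p.1} ↔
      (∀ k, ∀ u ∈ F k, ∀ v ∈ F k, ¬ (H k).Adj u v) ∧
      (∀ k l, G.Adj k l → x k ∈ F k → x l ∈ F l → False) ∧
      (∀ k, ∀ y, y ∉ F k → (∃ a ∈ F k, (H k).Adj y a) ∨
        (y = x k ∧ ∃ l, G.Adj k l ∧ x l ∈ F l)) := by
  rw [maxIndep_iff]
  constructor
  · rintro ⟨-, h2, h3⟩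
    refine ⟨fun k u hu v hv huv => h2 ⟨k, u⟩ hu ⟨k, v⟩ hv ((rp_adj_same ..).2 huv),
      fun k l hkl hk hl => h2 ⟨k, x k⟩ hk ⟨l, x l⟩ hl
        ((rp_adj_diff _ _ _ _ _ hkl.ne _ _).2 ⟨hkl, rfl, rfl⟩), fun k y hy => ?_⟩
    obtain ⟨⟨l, a⟩, ha, hya⟩ := h3 ⟨k, y⟩ (Set.mem_univ _) hy
    by_cases hkl : k = l
    · subst hkl
      exact Or.inl ⟨a, ha, (rp_adj_same ..).1 hya⟩
    · obtain ⟨h, rfl, rfl⟩ := (rp_adj_diff _ _ _ _ _ hkl _ _).1 hya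
      exact Or.inr ⟨rfl, l, h, ha⟩
  · rintro ⟨h1, h2, h3⟩
    refine ⟨Set.subset_univ _, ?_, ?_⟩
    · rintro ⟨k, u⟩ hu ⟨l, v⟩ hv huv
      by_cases hkl : k = l
      · subst hkl
        exact h1 k u hu v hv ((rp_adj_same ..).1 huv)
      · obtain ⟨h, rfl, rfl⟩ := (rp_adj_diff _ _ _ _ _ hkl _ _).1 huv
        exact h2 k l h hu hv
    · rintro ⟨k, y⟩ - hy
      obtain ⟨a, ha, hya⟩ | ⟨rfl, l, hkl, hl⟩ := h3 k y hy
      · exact ⟨⟨k, a⟩, ha, (rp_adj_same ..).2 hya⟩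
      · exact ⟨⟨l, x l⟩, hl, (rp_adj_diff _ _ _ _ _ hkl.ne _ _).2 ⟨hkl, rfl, rfl⟩⟩

theorem ncard_fam {m : ℕ} {W : Fin m → Type*} [∀ i, Fintype (W i)] (F : ∀ i, Set (W i)) :
    ({p | p.2 ∈ F p.1} : Set (Σ i, W i)).ncard = ∑ i, (F i).ncard := by
  have : ({p | p.2 ∈ F p.1} : Set (Σ i, W i)) =
      ((Finset.univ.sigma fun i => (F i).toFinset : Finset (Σ i, W i)) : Set (Σ i, W i)) := by
    ext p; simp
  rw [this, Set.ncard_coe_finset, Finset.card_sigma]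
  simp [Set.ncard_eq_toFinset_card']

theorem key_cmp {m : ℕ} {W : Fin m → Type*} [∀ i, Fintype (W i)] (G : SimpleGraph (Fin m))
    (H : ∀ i, SimpleGraph (W i)) (x : ∀ i, W i) (hw : (rootedProduct G H x).WellCovered)
    (F F' : ∀ i, Set (W i)) (i : Fin m) (he : ∀ k, k ≠ i → F k = F' k)
    (h : (rootedProduct G H x).IsMaxIndepOn Set.univ {p | p.2 ∈ F p.1})
    (h' : (rootedProduct G H x).IsMaxIndepOn Set.univ {p | p.2 ∈ F' p.1}) :
    (F i).ncard = (F' i).ncard := by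
  have e := (hw _ h).trans (hw _ h').symm
  rw [ncard_fam, ncard_fam, ← Finset.add_sum_erase _ _ (Finset.mem_univ i),
    ← Finset.add_sum_erase _ (fun i => (F' i).ncard) (Finset.mem_univ i)] at e
  have : ∑ k ∈ Finset.univ.erase i, (F k).ncard = ∑ k ∈ Finset.univ.erase i, (F' k).ncard :=
    Finset.sum_congr rfl fun k hk => by rw [he k (Finset.ne_of_mem_erase hk)]
  omega

theorem stmt3 {m : ℕ} {W : Fin m → Type*} [∀ i, Fintype (W i)]
    (H : ∀ i, SimpleGraph (W i)) (x : ∀ i, W i)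
    (hstar : ∀ G0 : SimpleGraph (Fin m), ConditionStarOn G0 H x)
    (hcard : ∀ i, 2 ≤ Fintype.card (W i))
    (𝒢 : Set (SimpleGraph (Fin m)))
    (h𝒢 : ∀ i : Fin m, ∃ G ∈ 𝒢, ∃ j, G.Adj i j) :
    (∀ i, (H i).TwoPureAt (x i)) ↔
      (∀ G ∈ 𝒢, (rootedProduct G H x).WellCovered) := by
  constructor
  · intro h G _
    refine (wc_of_const _ _ (∑ i, (H i).alphaOn Set.univ) fun A hA => ?_).1
    have hA' : A = {p | p.2 ∈ (fun i => {w : W i | (⟨i, w⟩ : Σ i, W i) ∈ A}) p.1} := by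
      ext ⟨i, w⟩; rfl
    rw [hA'] at hA
    rw [hA']
    refine (ncard_fam (fun i => {w : W i | (⟨i, w⟩ : Σ i, W i) ∈ A})).trans ?_
    obtain ⟨h1, h2, h3⟩ := (rp_max G H x (fun i => {w : W i | (⟨i, w⟩ : Σ i, W i) ∈ A})).1 hA
    refine Finset.sum_congr rfl fun i _ => ?_
    obtain ⟨w1, w2, w3⟩ := h i
    by_cases hx : (⟨i, x i⟩ : Σ i, W i) ∈ A
    · apply w1
      rw [maxIndep_iff]
      refine ⟨Set.subset_univ _, h1 i, fun y _ hy => ?_⟩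
      obtain h | ⟨rfl, -⟩ := h3 i y hy
      · exact h
      · exact absurd hx hy
    · rw [← w3]
      apply w2
      rw [maxIndep_iff]
      refine ⟨?_, h1 i, fun y hyx hy => ?_⟩
      · rintro y hy rfl
        exact hx hy
      obtain h | ⟨rfl, -⟩ := h3 i y hy
      · exact h
      · exact absurd rfl hyx
  · intro h
    have hex : ∀ i (w : W i), ∃ B, (H i).IsMaxIndepOn Set.univ B ∧ w ∈ B := fun i w => by
      obtain ⟨B, hB, hw⟩ := exists_max_of_indep (H i) Set.univ {w} (Set.subset_univ _)
        (Set.pairwise_singleton _ _)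
      exact ⟨B, hB, hw rfl⟩
    have hE : ∀ i, ∃ E, (H i).IsMaxIndepOn Set.univ E ∧ x i ∉ E := fun i => by
      have hnt : Nontrivial (W i) := Fintype.one_lt_card_iff_nontrivial.1 (hcard i)
      obtain ⟨y, hy⟩ := ((hstar ⊥).2.1 i).preconnected.exists_adj_of_nontrivial (x i)
      obtain ⟨B, hB, hyB⟩ := hex i y
      exact ⟨B, hB, fun hx => ((maxIndep_iff ..).1 hB).2.1 _ hx _ hyB hy⟩
    choose E hE hxE using hE
    choose B hB hxB using fun i => hex i (x i)
    simp only [maxIndep_iff] at hE hB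
    intro i
    obtain ⟨G, hG, j, hij⟩ := h𝒢 i
    have hw := h G hG
    have c1 : ∀ A, (H i).IsMaxIndepOn Set.univ A → A.ncard = (E i).ncard := by
      intro A hA
      rw [maxIndep_iff] at hA
      have := key_cmp G H x hw (Function.update E i A) E i
        (fun k hk => Function.update_of_ne hk _ _) ?_ ?_
      · simpa using this
      · rw [rp_max]
        refine ⟨fun k => ?_, fun k l hkl hk hl => ?_, fun k y hy => Or.inl ?_⟩
        · by_cases hk : k = i
          · subst hk; simpa using hA.2.1
          · simpa [hk] using (hE k).2.1
        · by_cases hki : k = i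
          · have hli : l ≠ i := fun e => hkl.ne (hki.trans e.symm)
            rw [Function.update_of_ne hli] at hl
            exact hxE l hl
          · rw [Function.update_of_ne hki] at hk
            exact hxE k hk
        · by_cases hk : k = i
          · subst hk
            simp only [Function.update_self] at hy ⊢
            exact hA.2.2 y trivial hy
          · rw [Function.update_of_ne hk] at hy ⊢
            exact (hE k).2.2 y trivial hy
      · rw [rp_max]
        exact ⟨fun k => (hE k).2.1, fun k l _ hk _ => hxE k hk,
          fun k y hy => Or.inl ((hE k).2.2 y trivial hy)⟩
    have c2 : ∀ A, (H i).IsMaxIndepOn {x i}ᶜ A → A.ncard = (E i).ncard := by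
      have gen : ∀ A, (H i).IsMaxIndepOn {x i}ᶜ A →
          (rootedProduct G H x).IsMaxIndepOn Set.univ
            {p | p.2 ∈ (Function.update (Function.update E j (B j)) i A) p.1} := by
        intro A hA
        rw [maxIndep_iff] at hA
        have hroot : ∀ k, x k ∈ Function.update (Function.update E j (B j)) i A k → k = j := by
          intro k hk
          by_cases hki : k = i
          · subst hki
            rw [Function.update_self] at hk
            exact absurd rfl (hA.1 hk)
          · rw [Function.update_of_ne hki] at hk
            by_contra hkj
            rw [Function.update_of_ne hkj] at hk
            exact hxE k hk
        rw [rp_max]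
        refine ⟨fun k => ?_, fun k l hkl hk hl => ?_, fun k y hy => ?_⟩
        · by_cases hk : k = i
          · subst hk; simpa using hA.2.1
          · rw [Function.update_of_ne hk]
            by_cases hkj : k = j
            · subst hkj; simpa using (hB k).2.1
            · rw [Function.update_of_ne hkj]; exact (hE k).2.1
        · exact hkl.ne ((hroot k hk).trans (hroot l hl).symm)
        · by_cases hk : k = i
          · subst hk
            by_cases hyx : y = x k
            · refine Or.inr ⟨hyx, j, hij, ?_⟩
              rw [Function.update_of_ne hij.ne', Function.update_self]
              exact hxB j
            · rw [Function.update_self] at hy ⊢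
              exact Or.inl (hA.2.2 y hyx hy)
          · rw [Function.update_of_ne hk] at hy ⊢
            left
            by_cases hkj : k = j
            · subst hkj
              rw [Function.update_self] at hy ⊢
              exact (hB k).2.2 y trivial hy
            · rw [Function.update_of_ne hkj] at hy ⊢
              exact (hE k).2.2 y trivial hy
      intro A hA
      have hEi : (H i).IsMaxIndepOn {x i}ᶜ (E i) := by
        rw [maxIndep_iff]
        refine ⟨?_, (hE i).2.1, fun y _ hy => (hE i).2.2 y trivial hy⟩
        rintro y hy rfl
        exact hxE i hy
      have := key_cmp G H x hw _ _ i (fun k hk => by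
        rw [Function.update_of_ne hk, Function.update_of_ne hk]) (gen A hA) (gen _ hEi)
      simpa using this
    obtain ⟨a1, a2⟩ := wc_of_const _ _ _ c1
    obtain ⟨b1, b2⟩ := wc_of_const _ _ _ c2
    exact ⟨a1, b1, b2.trans a2.symm⟩
end

section
/- Let H_1,…,H_m be graphs with pairwise disjoint vertex sets, with fixed roots x_i ∈ V(H_i), and assume condition (*). Then the following are equivalent: (1) for every i, H_i is vertex decomposable with x_i a shedding vertex, and H_i is 2-pure with respect to x_i; (2) the rooted product G_0(ℋ) is well-covered and vertex decomposable for every graph G_0 on X_[m] = {x_1,…,x_m}. -/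
open Classical

variable {V : Type*}

/-- Vertex decomposability of the independence complex of the induced subgraph of `G`
on the vertex set `s`: either the complex is a simplex (i.e. `s` is independent), or
there is a vertex `x ∈ s` such that the deletion (the induced subgraph on `s \ {x}`)
and the link (the induced subgraph on `s` minus the closed neighbourhood of `x`) are
vertex decomposable and every facet of the deletion is a facet (i.e. every maximal
independent set of `G|_{s \ {x}}` is a maximal independent set of `G|_s`). -/
inductive SimpleGraph.VDOn {V : Type*} (G : SimpleGraph V) : Set V → Prop
  | simplex (s : Set V) (h : G.IsIndepSet' s) : G.VDOn s
  | shed (s : Set V) (x : V) (hx : x ∈ s)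
      (hdel : G.VDOn (s \ {x}))
      (hlink : G.VDOn (s \ {y | y = x ∨ G.Adj x y}))
      (hfacet : ∀ A : Set V, G.IsMaxIndepOn (s \ {x}) A → G.IsMaxIndepOn s A) :
      G.VDOn s

/-- A graph is vertex decomposable if its independence complex is. -/
def SimpleGraph.VertexDecomposable {V : Type*} (G : SimpleGraph V) : Prop :=
  G.VDOn Set.univ

/-- `x` is a shedding vertex of `G`: `G - x` and `G - N[x]` are vertex decomposable
and every maximal independent set of `G - x` is a maximal independent set of `G`. -/
def SimpleGraph.SheddingVertex {V : Type*} (G : SimpleGraph V) (x : V) : Prop :=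
  G.VDOn {x}ᶜ ∧ G.VDOn {y | y = x ∨ G.Adj x y}ᶜ ∧
    ∀ A : Set V, G.IsMaxIndepOn {x}ᶜ A → G.IsMaxIndepOn Set.univ A

namespace RP

section gen
variable {U : Type*} {G : SimpleGraph U}

theorem max_iff {s A : Set U} : G.IsMaxIndepOn s A ↔
    A ⊆ s ∧ G.IsIndepSet' A ∧ ∀ v ∈ s, v ∉ A → ∃ u ∈ A, G.Adj u v := by
  constructor
  · rintro ⟨h1, h2, h3⟩
    refine ⟨h1, h2, fun v hv hvA => ?_⟩
    by_contra hcon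
    push Not at hcon
    have := h3 (insert v A) (Set.insert_subset hv h1) (by
      intro a ha b hb hab
      rcases ha with rfl | ha <;> rcases hb with rfl | hb
      · exact absurd rfl hab
      · exact fun h => hcon b hb h.symm
      · exact hcon a ha
      · exact h2 ha hb hab) (Set.subset_insert _ _)
    exact hvA (this ▸ Set.mem_insert _ _)
  · rintro ⟨h1, h2, h3⟩
    refine ⟨h1, h2, fun B hB hBi hAB => Set.Subset.antisymm hAB fun v hv => ?_⟩
    by_contra hvA
    obtain ⟨u, hu, huv⟩ := h3 v (hB hv) hvA
    exact hBi (hAB hu) hv huv.ne huv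

theorem extend [Finite U] {s A : Set U} (hA : A ⊆ s) (hi : G.IsIndepSet' A) :
    ∃ B, A ⊆ B ∧ G.IsMaxIndepOn s B := by
  obtain ⟨B, hAB, hB⟩ := (Set.toFinite {B : Set U | B ⊆ s ∧ G.IsIndepSet' B}).exists_le_maximal
    (show A ∈ _ from ⟨hA, hi⟩)
  refine ⟨B, hAB, hB.prop.1, hB.prop.2, fun C hC hCi hBC => ?_⟩
  exact Set.Subset.antisymm hBC (hB.le_of_ge ⟨hC, hCi⟩ hBC)

theorem le_alpha [Finite U] {s A : Set U} (hA : A ⊆ s) (hi : G.IsIndepSet' A) :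
    A.ncard ≤ G.alphaOn s := by
  refine le_csSup ⟨Nat.card U, ?_⟩ ⟨A, hA, hi, rfl⟩
  rintro n ⟨B, -, -, rfl⟩
  exact Set.ncard_le_card B

theorem alpha_eq [Finite U] {s : Set U} {c : ℕ} (h : ∀ A, G.IsMaxIndepOn s A → A.ncard = c) :
    G.alphaOn s = c := by
  apply le_antisymm
  · refine csSup_le ⟨0, ∅, by simp, by simp [SimpleGraph.IsIndepSet'], by simp⟩ ?_
    rintro n ⟨B, hB, hBi, rfl⟩
    obtain ⟨C, hBC, hC⟩ := extend hB hBi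
    rw [← h C hC]
    exact Set.ncard_le_ncard hBC
  · obtain ⟨C, hBC, hC⟩ := extend (G := G) (Set.empty_subset s) (by simp [SimpleGraph.IsIndepSet'])
    rw [← h C hC]
    exact le_alpha hC.1 hC.2.1

theorem wc_of [Finite U] {s : Set U} {c : ℕ} (h : ∀ A, G.IsMaxIndepOn s A → A.ncard = c) :
    G.WellCoveredOn s := fun A hA => by rw [alpha_eq h, h A hA]

theorem max_of_card [Finite U] {s A : Set U} (hA : A ⊆ s) (hi : G.IsIndepSet' A)
    (hc : A.ncard = G.alphaOn s) : G.IsMaxIndepOn s A := by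
  obtain ⟨C, hBC, hC⟩ := extend hA hi
  have : A = C := Set.eq_of_subset_of_ncard_le hBC (by rw [hc]; exact le_alpha hC.1 hC.2.1)
  rwa [this]

/-- closed neighbourhood of a set -/
def nb (G : SimpleGraph U) (A : Set U) : Set U := {y | ∃ a ∈ A, y = a ∨ G.Adj a y}

theorem link1 {s : Set U} (h : G.VDOn s) : ∀ v ∈ s, G.VDOn (s \ {y | y = v ∨ G.Adj v y}) := by
  induction h with
  | simplex s h =>
    intro v hv
    exact .simplex _ (h.mono Set.sdiff_subset)
  | shed s x hx hdel hlink hf ih1 ih2 =>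
    intro v hv
    by_cases hvx : v = x
    · rw [hvx]; exact hlink
    have h1 := ih1 v ⟨hv, hvx⟩
    by_cases hadj : G.Adj v x
    · convert h1 using 1
      ext y
      simp only [Set.mem_sdiff, Set.mem_ofPred_eq, Set.mem_singleton_iff]
      constructor
      · rintro ⟨a, b⟩
        exact ⟨⟨a, fun h => b (Or.inr (h ▸ hadj))⟩, b⟩
      · rintro ⟨⟨a, _⟩, b⟩; exact ⟨a, b⟩
    · have hadj' : ¬ G.Adj x v := fun h => hadj h.symm
      have h2 := ih2 v ⟨hv, by simp [hvx, hadj']⟩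
      refine .shed _ x ⟨hx, by simp [hadj, Ne.symm hvx]⟩ ?_ ?_ ?_
      · rwa [Set.sdiff_sdiff_comm]
      · rwa [Set.sdiff_sdiff_comm]
      · intro A hA
        rw [max_iff] at hA
        obtain ⟨a1, a2, a3⟩ := hA
        have : G.IsMaxIndepOn (s \ {x}) (insert v A) := by
          rw [max_iff]
          refine ⟨?_, ?_, ?_⟩
          · rintro y (rfl | hy)
            · exact ⟨hv, hvx⟩
            · exact ⟨(a1 hy).1.1, (a1 hy).2⟩
          · intro a ha b hb hab
            rcases ha with rfl | ha <;> rcases hb with rfl | hb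
            · exact absurd rfl hab
            · exact fun h => (a1 hb).1.2 (Or.inr h)
            · exact fun h => (a1 ha).1.2 (Or.inr h.symm)
            · exact a2 ha hb hab
          · intro w hw hwA
            by_cases hwv : G.Adj v w
            · exact ⟨v, Set.mem_insert _ _, hwv⟩
            · obtain ⟨u, hu, huw⟩ := a3 w ⟨⟨hw.1, by
                rintro (h | h)
                · exact hwA (h ▸ Set.mem_insert _ _)
                · exact hwv h⟩, hw.2⟩ (fun h => hwA (Set.mem_insert_of_mem _ h))
              exact ⟨u, Set.mem_insert_of_mem _ hu, huw⟩
        have := max_iff.1 (hf _ this)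
        rw [max_iff]
        refine ⟨fun y hy => (a1 hy).1, a2, fun w hw hwA => ?_⟩
        obtain ⟨u, hu, huw⟩ := this.2.2 w hw.1 (by
          rintro (h | h)
          · exact hw.2 (Or.inl h)
          · exact hwA h)
        rcases hu with rfl | hu
        · exact absurd (Or.inr huw) hw.2
        · exact ⟨u, hu, huw⟩

theorem link {s A : Set U} (h : G.VDOn s) (hfin : A.Finite) (hA : A ⊆ s) (hi : G.IsIndepSet' A) :
    G.VDOn (s \ nb G A) := by
  induction A, hfin using Set.Finite.induction_on with
  | empty => simpa [nb] using h
  | @insert a A ha _ ih =>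
    have h1 := ih ((Set.subset_insert _ _).trans hA) (hi.mono (Set.subset_insert _ _))
    have h2 := link1 h1 a ⟨hA (Set.mem_insert _ _), by
      rintro ⟨b, hb, rfl | hab⟩
      · exact ha hb
      · exact hi (Set.mem_insert_of_mem _ hb) (Set.mem_insert _ _) hab.ne hab⟩
    convert h2 using 1
    ext y
    simp only [nb, Set.mem_sdiff, Set.mem_ofPred_eq, Set.mem_insert_iff]
    constructor
    · rintro ⟨p, q⟩
      exact ⟨⟨p, fun ⟨b, hb, hy⟩ => q ⟨b, Or.inr hb, hy⟩⟩, fun hy => q ⟨a, Or.inl rfl, hy⟩⟩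
    · rintro ⟨⟨p, q⟩, r⟩
      refine ⟨p, ?_⟩
      rintro ⟨b, rfl | hb, hy⟩
      · exact r hy
      · exact q ⟨b, hb, hy⟩

theorem shed_add {s t : Set U} {x : U} (hx : x ∈ s) (hst : Disjoint s t)
    (hno : ∀ a ∈ s, ∀ b ∈ t, ¬ G.Adj a b)
    (hf : ∀ A : Set U, G.IsMaxIndepOn (s \ {x}) A → G.IsMaxIndepOn s A) :
    ∀ A : Set U, G.IsMaxIndepOn ((s ∪ t) \ {x}) A → G.IsMaxIndepOn (s ∪ t) A := by
  intro A hA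
  rw [max_iff] at hA ⊢
  obtain ⟨a1, a2, a3⟩ := hA
  refine ⟨a1.trans Set.sdiff_subset, a2, fun v hv hvA => ?_⟩
  by_cases hvx : v = x
  · subst hvx
    have : G.IsMaxIndepOn (s \ {v}) (A ∩ s) := by
      rw [max_iff]
      refine ⟨fun y hy => ⟨hy.2, (a1 hy.1).2⟩, a2.mono Set.inter_subset_left, fun w hw hwA => ?_⟩
      obtain ⟨u, hu, huw⟩ := a3 w ⟨Or.inl hw.1, hw.2⟩ (fun h => hwA ⟨h, hw.1⟩)
      refine ⟨u, ⟨hu, ?_⟩, huw⟩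
      rcases (a1 hu).1 with h | h
      · exact h
      · exact absurd huw.symm (hno w hw.1 u h)
    obtain ⟨u, hu, huv⟩ := (max_iff.1 (hf _ this)).2.2 v hx (fun h => hvA h.1)
    exact ⟨u, hu.1, huv⟩
  · exact a3 v ⟨hv, hvx⟩ hvA

theorem vd_union {s t : Set U} (hs : G.VDOn s) (ht : G.VDOn t) (hst : Disjoint s t)
    (hno : ∀ a ∈ s, ∀ b ∈ t, ¬ G.Adj a b) : G.VDOn (s ∪ t) := by
  induction hs with
  | simplex s h =>
    induction ht with
    | simplex t h' =>
      refine .simplex _ ?_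
      intro a ha b hb hab
      rcases ha with ha | ha <;> rcases hb with hb | hb
      · exact h ha hb hab
      · exact hno a ha b hb
      · exact fun h => hno b hb a ha h.symm
      · exact h' ha hb hab
    | shed t x hx hdel hlink hf ih1 ih2 =>
      have hxs : x ∉ s := fun h => Set.disjoint_left.1 hst h hx
      refine .shed _ x (Or.inr hx) ?_ ?_ ?_
      · have := ih1 (hst.mono_right Set.sdiff_subset) (fun a ha b hb => hno a ha b hb.1)
        rwa [Set.union_sdiff_distrib, Set.sdiff_singleton_eq_self hxs]
      · have := ih2 (hst.mono_right Set.sdiff_subset) (fun a ha b hb => hno a ha b hb.1)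
        rw [Set.union_sdiff_distrib]
        have e : s \ {y | y = x ∨ G.Adj x y} = s := by
          apply Disjoint.sdiff_eq_left
          rw [Set.disjoint_left]
          rintro a ha (rfl | h)
          · exact hxs ha
          · exact hno a ha x hx h.symm
        rwa [e]
      · rw [Set.union_comm]
        exact shed_add hx hst.symm (fun a ha b hb h => hno b hb a ha h.symm) hf
  | shed s x hx hdel hlink hf ih1 ih2 =>
    have hxs : x ∉ t := fun h => Set.disjoint_left.1 hst hx h
    refine .shed _ x (Or.inl hx) ?_ ?_ ?_
    · have := ih1 (hst.mono_left Set.sdiff_subset) (fun a ha b hb => hno a ha.1 b hb)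
      rwa [Set.union_sdiff_distrib, Set.sdiff_singleton_eq_self hxs]
    · have := ih2 (hst.mono_left Set.sdiff_subset) (fun a ha b hb => hno a ha.1 b hb)
      rw [Set.union_sdiff_distrib]
      have e : t \ {y | y = x ∨ G.Adj x y} = t := by
        apply Disjoint.sdiff_eq_left
        rw [Set.disjoint_left]
        rintro a ha (rfl | h)
        · exact hxs ha
        · exact hno x hx a ha h
      rwa [e]
    · exact shed_add hx hst hno hf

variable {U' : Type*} {K : SimpleGraph U'} (f : K ↪g G)

theorem max_image {s A : Set U'} : G.IsMaxIndepOn (f '' s) (f '' A) ↔ K.IsMaxIndepOn s A := by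
  rw [max_iff, max_iff]
  refine and_congr (Set.image_subset_image_iff f.injective) (and_congr ?_ ?_)
  · unfold SimpleGraph.IsIndepSet'
    rw [Set.InjOn.pairwise_image f.injective.injOn]
    simp [Set.Pairwise, Function.onFun]
  · simp only [Set.forall_mem_image, Set.exists_mem_image, f.injective.mem_set_image, f.map_adj_iff]

theorem diff1 (s : Set U') (x : U') : f '' (s \ {x}) = f '' s \ {f x} := by
  rw [Set.image_sdiff f.injective, Set.image_singleton]

theorem diff2 (s : Set U') (x : U') :
    f '' (s \ {y | y = x ∨ K.Adj x y}) = f '' s \ {y | y = f x ∨ G.Adj (f x) y} := by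
  ext y
  constructor
  · rintro ⟨z, ⟨hz, hz'⟩, rfl⟩
    refine ⟨⟨z, hz, rfl⟩, ?_⟩
    simpa using hz'
  · rintro ⟨⟨z, hz, rfl⟩, h⟩
    exact ⟨z, ⟨hz, by simpa using h⟩, rfl⟩

theorem vd_image {s : Set U'} (h : K.VDOn s) : G.VDOn (f '' s) := by
  induction h with
  | simplex s h =>
    refine .simplex _ ?_
    unfold SimpleGraph.IsIndepSet' at *
    rw [Set.InjOn.pairwise_image f.injective.injOn]
    simpa [Set.Pairwise, Function.onFun] using h
  | shed s x hx _ _ hf ih1 ih2 =>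
    refine .shed _ (f x) ⟨x, hx, rfl⟩ ?_ ?_ ?_
    · rwa [← diff1]
    · rwa [← diff2]
    · intro A hA
      rw [← diff1] at hA
      obtain ⟨B, -, rfl⟩ := Set.subset_image_iff.1 hA.1
      rw [max_image] at *
      exact hf _ hA

theorem vd_of_image {t : Set U} (h : G.VDOn t) : ∀ s : Set U', t = f '' s → K.VDOn s := by
  induction h with
  | simplex t h =>
    rintro s rfl
    refine .simplex _ ?_
    unfold SimpleGraph.IsIndepSet' at *
    rw [Set.InjOn.pairwise_image f.injective.injOn] at h
    simpa [Set.Pairwise, Function.onFun] using h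
  | shed t x hx _ _ hf ih1 ih2 =>
    rintro s rfl
    obtain ⟨x, hx, rfl⟩ := hx
    refine .shed _ x hx ?_ ?_ ?_
    · exact ih1 _ (diff1 _ _ _).symm
    · exact ih2 _ (diff2 _ _ _).symm
    · intro A hA
      rw [← diff1] at hf
      rw [← max_image f] at *
      exact hf _ hA

end gen

section prod
variable {m : ℕ} {W : Fin m → Type*} {G0 : SimpleGraph (Fin m)}
    {H : ∀ i, SimpleGraph (W i)} {x : ∀ i, W i}

theorem adj_same {i : Fin m} {u v : W i} :
    (rootedProduct G0 H x).Adj ⟨i, u⟩ ⟨i, v⟩ ↔ (H i).Adj u v := by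
  unfold rootedProduct
  rw [SimpleGraph.fromRel_adj]
  simp only [SimpleGraph.irrefl, false_and, or_false, exists_const]
  constructor
  · rintro ⟨-, h | h⟩
    · exact h
    · exact h.symm
  · intro h
    refine ⟨?_, Or.inl h⟩
    intro e
    obtain rfl : u = v := by simpa using e
    exact h.ne rfl

theorem adj_diff {i j : Fin m} (hij : i ≠ j) {u : W i} {v : W j} :
    (rootedProduct G0 H x).Adj ⟨i, u⟩ ⟨j, v⟩ ↔ G0.Adj i j ∧ u = x i ∧ v = x j := by
  unfold rootedProduct
  rw [SimpleGraph.fromRel_adj]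
  constructor
  · rintro ⟨-, (⟨h, -⟩ | h) | (⟨h, -⟩ | h)⟩
    · exact absurd h hij
    · exact h
    · exact absurd h.symm hij
    · exact ⟨h.1.symm, h.2.2, h.2.1⟩
  · intro h
    exact ⟨fun e => hij (congrArg Sigma.fst e), Or.inl (Or.inr h)⟩

/-- inclusion of a factor -/
def emb (G0 : SimpleGraph (Fin m)) (H : ∀ i, SimpleGraph (W i)) (x : ∀ i, W i) (i : Fin m) :
    H i ↪g rootedProduct G0 H x where
  toFun u := ⟨i, u⟩
  inj' := sigma_mk_injective
  map_rel_iff' := adj_same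

/-- union of a family of sets -/
def un (A : ∀ i, Set (W i)) : Set (Σ i, W i) := {a | a.2 ∈ A a.1}

theorem mem_un {A : ∀ i, Set (W i)} {i : Fin m} {u : W i} :
    (⟨i, u⟩ : Σ i, W i) ∈ un A ↔ u ∈ A i := Iff.rfl

theorem ncard_un [∀ i, Fintype (W i)] (A : ∀ i, Set (W i)) :
    (un A).ncard = ∑ i, (A i).ncard := by
  have : un A = ((Finset.univ.sigma fun i => (A i).toFinset : Finset (Σ i, W i)) : Set _) := by
    ext a; simp [un]
  rw [this, Set.ncard_coe_finset, Finset.card_sigma]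
  simp [Set.ncard_eq_toFinset_card']

theorem vd_sigma (s : ∀ i, Set (W i)) (hs : ∀ i, (H i).VDOn (s i)) (hx : ∀ i, x i ∉ s i) :
    (rootedProduct G0 H x).VDOn (un s) := by
  have key : ∀ I : Finset (Fin m), (rootedProduct G0 H x).VDOn {a | a.1 ∈ I ∧ a.2 ∈ s a.1} := by
    intro I
    induction I using Finset.induction_on with
    | empty => exact .simplex _ (by simp [SimpleGraph.IsIndepSet'])
    | insert i I hi ih =>
      have h1 := vd_image (emb G0 H x i) (hs i)
      have h2 := vd_union h1 ih (by
        rw [Set.disjoint_left]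
        rintro _ ⟨u, hu, rfl⟩ h
        exact hi h.1) (by
        rintro _ ⟨u, hu, rfl⟩ ⟨j, v⟩ ⟨hj, hv⟩ h
        have hij : i ≠ j := fun e => hi (e ▸ hj)
        have := (adj_diff hij).1 h
        exact hx i (this.2.1 ▸ hu))
      convert h2 using 1
      ext ⟨j, v⟩
      simp only [Finset.mem_insert, Set.mem_union, Set.mem_ofPred_eq]
      constructor
      · rintro ⟨rfl | h, hv⟩
        · exact Or.inl ⟨v, hv, rfl⟩
        · exact Or.inr ⟨h, hv⟩
      · rintro (⟨u, hu, he⟩ | h)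
        · cases he
          exact ⟨Or.inl rfl, hu⟩
        · exact ⟨Or.inr h.1, h.2⟩
  convert key Finset.univ using 1
  ext a
  simp [un]

theorem restrict_max (s : ∀ i, Set (W i)) {A : Set (Σ i, W i)} {i : Fin m}
    (hA : (rootedProduct G0 H x).IsMaxIndepOn (un s) A) :
    (H i).IsMaxIndepOn (s i) {u | (⟨i, u⟩ : Σ i, W i) ∈ A} ∨
    (⟨i, x i⟩ : Σ i, W i) ∉ A ∧
    (H i).IsMaxIndepOn (s i \ {x i}) {u | (⟨i, u⟩ : Σ i, W i) ∈ A} := by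
  rw [max_iff] at hA
  obtain ⟨a1, a2, a3⟩ := hA
  have hind : (H i).IsIndepSet' {u | (⟨i, u⟩ : Σ i, W i) ∈ A} := by
    intro u hu v hv huv h
    exact a2 hu hv (fun e => huv (sigma_mk_injective e)) (adj_same.2 h)
  have hmax : ∀ v ∈ s i, v ≠ x i → (⟨i, v⟩ : Σ i, W i) ∉ A →
      ∃ u, (⟨i, u⟩ : Σ i, W i) ∈ A ∧ (H i).Adj u v := by
    intro v hv hvx hvA
    obtain ⟨⟨j, u⟩, hu, huv⟩ := a3 ⟨i, v⟩ hv hvA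
    by_cases hij : j = i
    · subst hij
      exact ⟨u, hu, adj_same.1 huv⟩
    · exact absurd ((adj_diff hij).1 huv).2.2 hvx
  by_cases hx : (⟨i, x i⟩ : Σ i, W i) ∈ A
  · left
    rw [max_iff]
    refine ⟨fun u hu => a1 hu, hind, fun v hv hvA => ?_⟩
    exact hmax v hv (fun e => hvA (e ▸ hx)) hvA
  · right
    refine ⟨hx, ?_⟩
    rw [max_iff]
    refine ⟨fun u hu => ⟨a1 hu, ?_⟩, hind, fun v hv hvA => hmax v hv.1 hv.2 hvA⟩
    rintro rfl
    exact hx hu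

theorem vd_state (hsh : ∀ i, (H i).SheddingVertex (x i)) (n : ℕ) :
    ∀ (s : ∀ i, Set (W i)), (∀ i, s i = Set.univ ∨ (x i ∉ s i ∧ (H i).VDOn (s i))) →
    (Finset.univ.filter fun i => x i ∈ s i).card ≤ n →
    (rootedProduct G0 H x).VDOn (un s) := by
  induction n with
  | zero =>
    intro s hs hc
    have hx : ∀ i, x i ∉ s i := by
      intro i hi
      have : (Finset.univ.filter fun i => x i ∈ s i) = ∅ := by simpa using hc
      have h2 : i ∈ (Finset.univ.filter fun i => x i ∈ s i) := by simp [hi]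
      rw [this] at h2
      simp at h2
    refine vd_sigma s (fun i => ?_) hx
    rcases hs i with h | h
    · exact absurd (by rw [h]; trivial) (hx i)
    · exact h.2
  | succ n ih =>
    intro s hs hc
    by_cases hall : ∀ i, x i ∉ s i
    · refine vd_sigma s (fun i => ?_) hall
      rcases hs i with h | h
      · exact absurd (by rw [h]; trivial) (hall i)
      · exact h.2
    push Not at hall
    obtain ⟨i, hi⟩ := hall
    have hsi : s i = Set.univ := (hs i).resolve_right fun h => h.1 hi
    have hcard : ∀ t : ∀ i, Set (W i), x i ∉ t i → (∀ j, t j ⊆ s j) →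
        (Finset.univ.filter fun i => x i ∈ t i).card ≤ n := by
      intro t ht hts
      have : (Finset.univ.filter fun i => x i ∈ t i) ⊂ (Finset.univ.filter fun i => x i ∈ s i) := by
        rw [Finset.ssubset_iff_of_subset]
        · exact ⟨i, by simp [hi], by simp [ht]⟩
        · intro j hj
          simp only [Finset.mem_filter, Finset.mem_univ, true_and] at hj ⊢
          exact hts j hj
      have := Finset.card_lt_card this
      omega
    refine .shed _ ⟨i, x i⟩ hi ?_ ?_ ?_
    · have := ih (fun j => if j = i then {x j}ᶜ else s j) (by
        intro j
        by_cases hj : j = i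
        · subst hj
          right
          simpa using (hsh j).1
        · simpa [hj] using hs j) (hcard _ (by simp) (by
          intro j
          by_cases hj : j = i
          · subst hj
            simp [hsi]
          · simp [hj]))
      convert this using 1
      ext ⟨j, v⟩
      simp only [Set.mem_sdiff, mem_un, Set.mem_singleton_iff]
      by_cases hj : j = i
      · subst hj
        simp [hsi]
      · simp [hj]
    · have := ih (fun j => if j = i then {y | y = x j ∨ (H j).Adj (x j) y}ᶜ else
          if G0.Adj i j then s j \ {x j} else s j) (by
        intro j
        by_cases hj : j = i
        · subst hj
          right
          simpa using (hsh j).2.1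
        · by_cases hadj : G0.Adj i j
          · right
            simp only [hj, hadj, if_true, if_false]
            refine ⟨by simp, ?_⟩
            rcases hs j with h | h
            · rw [h, ← Set.compl_eq_univ_sdiff]
              exact (hsh j).1
            · rw [Set.sdiff_singleton_eq_self h.1]
              exact h.2
          · simpa [hj, hadj] using hs j) (hcard _ (by simp) (by
          intro j
          by_cases hj : j = i
          · subst hj
            simp [hsi]
          · by_cases hadj : G0.Adj i j
            · simp [hj, hadj]
            · simp [hj, hadj]))
      convert this using 1
      ext ⟨j, v⟩
      simp only [Set.mem_sdiff, mem_un, Set.mem_ofPred_eq]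
      by_cases hj : j = i
      · subst hj
        simp [hsi, adj_same]
      · rw [adj_diff (Ne.symm hj)]
        by_cases hadj : G0.Adj i j
        · simp [hj, hadj]
        · simp [hj, hadj]
    · intro A hA
      have hA' : (rootedProduct G0 H x).IsMaxIndepOn
          (un fun j => if j = i then {x j}ᶜ else s j) A := by
        convert hA using 1
        ext ⟨j, v⟩
        simp only [Set.mem_sdiff, mem_un, Set.mem_singleton_iff]
        by_cases hj : j = i
        · subst hj
          simp [hsi]
        · simp [hj]
      have h1 : (H i).IsMaxIndepOn {x i}ᶜ {u | (⟨i, u⟩ : Σ i, W i) ∈ A} := by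
        rcases restrict_max (i := i) _ hA' with h | ⟨-, h⟩
        · simpa using h
        · simpa using h
      have h2 := max_iff.1 ((hsh i).2.2 _ h1)
      rw [max_iff] at hA ⊢
      refine ⟨hA.1.trans Set.sdiff_subset, hA.2.1, fun v hv hvA => ?_⟩
      by_cases hvx : v = ⟨i, x i⟩
      · subst hvx
        obtain ⟨u, hu, huv⟩ := h2.2.2 (x i) trivial hvA
        exact ⟨⟨i, u⟩, hu, adj_same.2 huv⟩
      · exact hA.2.2 v ⟨hv, hvx⟩ hvA

theorem forward [∀ i, Fintype (W i)]
    (h : ∀ i, (H i).SheddingVertex (x i) ∧ (H i).TwoPureAt (x i)) :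
    (rootedProduct G0 H x).WellCovered ∧ (rootedProduct G0 H x).VertexDecomposable := by
  have hu : un (fun i => (Set.univ : Set (W i))) = Set.univ := by ext; simp [un]
  constructor
  · refine wc_of (c := ∑ i, (H i).alphaOn Set.univ) fun A hA => ?_
    have e : A = un fun i => {u | (⟨i, u⟩ : Σ i, W i) ∈ A} := by ext ⟨i, u⟩; rfl
    rw [e, ncard_un]
    refine Finset.sum_congr rfl fun i _ => ?_
    rw [← hu] at hA
    rcases restrict_max (i := i) _ hA with h1 | ⟨-, h1⟩
    · exact (h i).2.1 _ h1
    · rw [← Set.compl_eq_univ_sdiff] at h1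
      rw [(h i).2.2.1 _ h1, (h i).2.2.2]
  · have := vd_state (G0 := G0) (fun i => (h i).1) _ (fun i => Set.univ) (fun i => Or.inl rfl) le_rfl
    rwa [hu] at this

theorem max_un {A : ∀ i, Set (W i)} (hi : ∀ i, (H i).IsIndepSet' (A i))
    (hc : ∀ i j, G0.Adj i j → x i ∈ A i → x j ∉ A j)
    (hm : ∀ i, ∀ v, v ∉ A i → (∃ u ∈ A i, (H i).Adj u v) ∨
      (v = x i ∧ ∃ j, G0.Adj j i ∧ x j ∈ A j)) :
    (rootedProduct G0 H x).IsMaxIndepOn Set.univ (un A) := by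
  rw [max_iff]
  refine ⟨Set.subset_univ _, ?_, ?_⟩
  · rintro ⟨i, u⟩ hu ⟨j, v⟩ hv huv h
    by_cases hij : i = j
    · subst hij
      exact hi i hu hv (adj_same.1 h).ne (adj_same.1 h)
    · obtain ⟨h1, rfl, rfl⟩ := (adj_diff hij).1 h
      exact hc i j h1 hu hv
  · rintro ⟨i, v⟩ - hv
    rcases hm i v hv with ⟨u, hu, huv⟩ | ⟨rfl, j, hj, hxj⟩
    · exact ⟨⟨i, u⟩, hu, adj_same.2 huv⟩
    · exact ⟨⟨j, x j⟩, hxj, (adj_diff hj.ne).2 ⟨hj, rfl, rfl⟩⟩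

theorem exists_mem [∀ i, Fintype (W i)] (i : Fin m) (v : W i) :
    ∃ A, v ∈ A ∧ (H i).IsMaxIndepOn Set.univ A := by
  obtain ⟨A, h1, h2⟩ := extend (G := H i) (A := {v}) (Set.subset_univ _)
    (by simp [SimpleGraph.IsIndepSet'])
  exact ⟨A, h1 rfl, h2⟩

theorem exists_not_mem [∀ i, Fintype (W i)] (i : Fin m) (hcon : (H i).Connected)
    (hne : ∃ u v, (H i).Adj u v) :
    ∃ A, x i ∉ A ∧ (H i).IsMaxIndepOn Set.univ A := by
  obtain ⟨u, v, huv⟩ := hne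
  have : Nontrivial (W i) := ⟨u, v, huv.ne⟩
  obtain ⟨y, hy⟩ := hcon.preconnected.exists_adj_of_nontrivial (x i)
  obtain ⟨A, h1, h2⟩ := exists_mem (H := H) i y
  exact ⟨A, fun h => h2.2.1 h h1 hy.ne hy, h2⟩

end prod

section back
variable {m : ℕ} {W : Fin m → Type*} [∀ i, Fintype (W i)]
    {H : ∀ i, SimpleGraph (W i)} {x : ∀ i, W i}

theorem sum_upd (M : ∀ i, Set (W i)) (i : Fin m) (N : Set (W i)) :
    (un (Function.update M i N)).ncard = N.ncard + ∑ k ∈ Finset.univ.erase i, (M k).ncard := by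
  rw [ncard_un, ← Finset.add_sum_erase _ _ (Finset.mem_univ i)]
  congr 1
  · simp
  · refine Finset.sum_congr rfl fun k hk => ?_
    rw [Function.update_of_ne (Finset.ne_of_mem_erase hk)]

theorem same_card (h : (rootedProduct ⊥ H x).WellCovered) {i : Fin m} {A B : Set (W i)}
    (hA : (H i).IsMaxIndepOn Set.univ A) (hB : (H i).IsMaxIndepOn Set.univ B) :
    A.ncard = B.ncard := by
  choose M hM1 hM using fun k => exists_mem (H := H) k (x k)
  have key : ∀ C, (H i).IsMaxIndepOn Set.univ C →
      C.ncard + ∑ k ∈ Finset.univ.erase i, (M k).ncard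
        = (rootedProduct ⊥ H x).alphaOn Set.univ := by
    intro C hC
    rw [← sum_upd]
    have hmax : ∀ k, (H k).IsMaxIndepOn Set.univ (Function.update M i C k) := by
      intro k
      by_cases hk : k = i
      · subst hk; simpa using hC
      · simpa [hk] using hM k
    refine h _ (max_un (fun k => (hmax k).2.1) (fun _ _ h => absurd h (by simp)) ?_)
    intro k v hv
    exact Or.inl ((max_iff.1 (hmax k)).2.2 v trivial hv)
  have := key A hA
  have := key B hB
  omega

theorem backward {i j : Fin m} (hij : i ≠ j)
    (hcon : ∀ i, (H i).Connected)
    (hne : ∃ k, (k = i ∨ k = j) ∧ ∃ u v, (H k).Adj u v)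
    (h : ∀ G0 : SimpleGraph (Fin m),
        (rootedProduct G0 H x).WellCovered ∧ (rootedProduct G0 H x).VertexDecomposable) :
    (H i).VertexDecomposable ∧ (H i).SheddingVertex (x i) ∧ (H i).TwoPureAt (x i) := by
  choose M hM1 hM using fun k => exists_mem (H := H) k (x k)
  have hMm : ∀ k, ∀ v ∉ M k, ∃ u ∈ M k, (H k).Adj u v := fun k v hv =>
    (max_iff.1 (hM k)).2.2 v trivial hv
  have hα : ∀ A, (H i).IsMaxIndepOn Set.univ A → A.ncard = (M i).ncard := fun A hA =>
    same_card (h ⊥).1 hA (hM i)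
  have hE : ∀ a b, (SimpleGraph.edge i j).Adj a b → (a = i ∧ b = j) ∨ (a = j ∧ b = i) := by
    intro a b hab
    rw [SimpleGraph.edge_adj] at hab
    tauto
  have hEij : (SimpleGraph.edge i j).Adj i j := by
    rw [SimpleGraph.edge_adj]; tauto
  have hsum : (rootedProduct (SimpleGraph.edge i j) H x).alphaOn Set.univ
      = (M i).ncard + ∑ k ∈ Finset.univ.erase i, (M k).ncard := by
    rw [Finset.add_sum_erase _ (fun k => (M k).ncard) (Finset.mem_univ i)]
    obtain ⟨k, hk, hadj⟩ := hne
    obtain ⟨N, hN1, hN⟩ := exists_not_mem (x := x) k (hcon k) hadj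
    have hmax : ∀ l, (H l).IsMaxIndepOn Set.univ (Function.update M k N l) := by
      intro l
      by_cases hl : l = k
      · subst hl; simpa using hN
      · simpa [hl] using hM l
    have hk' : x k ∉ Function.update M k N k := by simpa using hN1
    have := (h (SimpleGraph.edge i j)).1 _ (max_un (A := Function.update M k N)
      (fun l => (hmax l).2.1) (by
        intro a b hab ha hb
        rcases hE a b hab with ⟨rfl, rfl⟩ | ⟨rfl, rfl⟩ <;> rcases hk with rfl | rfl <;>
          first | exact hk' ha | exact hk' hb)
      (fun l v hv => Or.inl ((max_iff.1 (hmax l)).2.2 v trivial hv)))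
    rw [← this, sum_upd, same_card (h ⊥).1 hN (hM k),
      Finset.add_sum_erase _ (fun k => (M k).ncard) (Finset.mem_univ k)]
  have hB : ∀ B, (H i).IsMaxIndepOn {x i}ᶜ B → B.ncard = (M i).ncard := by
    intro B hB
    obtain ⟨b1, b2, b3⟩ := max_iff.1 hB
    have hxB : x i ∉ B := fun h => b1 h rfl
    have := (h (SimpleGraph.edge i j)).1 _ (max_un (A := Function.update M i B) (by
        intro l
        by_cases hl : l = i
        · subst hl; simpa using b2
        · simpa [hl] using (hM l).2.1) (by
        intro a b hab ha hb
        rcases hE a b hab with ⟨rfl, rfl⟩ | ⟨rfl, rfl⟩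
        · simp [hxB] at ha
        · simp [hxB] at hb) (by
        intro l v hv
        by_cases hl : l = i
        · subst hl
          by_cases hvx : v = x l
          · right
            refine ⟨hvx, j, hEij.symm, ?_⟩
            simpa [Ne.symm hij] using hM1 j
          · left
            simp only [Function.update_self] at hv ⊢
            exact b3 v hvx hv
        · left
          simp only [Function.update_of_ne hl] at hv ⊢
          exact hMm l v hv))
    rw [sum_upd, hsum] at this
    omega
  have ha1 := alpha_eq hα
  have ha2 := alpha_eq hB
  -- vertex decomposability
  have hmem : ∀ k, k ≠ i → ∀ u, u ∈ Function.update M i ∅ k ↔ u ∈ M k := by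
    intro k hk u
    rw [Function.update_of_ne hk]
  have hind : ∀ G0 : SimpleGraph (Fin m), (∀ a b, G0.Adj a b → a = i ∨ b = i) →
      (rootedProduct G0 H x).IsIndepSet' (un (Function.update M i ∅)) := by
    rintro G0 hG ⟨a, u⟩ hu ⟨b, v⟩ hv - hadj
    have hai : a ≠ i := by rintro rfl; simp [mem_un] at hu
    have hbi : b ≠ i := by rintro rfl; simp [mem_un] at hv
    rw [mem_un, hmem a hai] at hu
    rw [mem_un, hmem b hbi] at hv
    by_cases hab : a = b
    · subst hab
      exact (hM a).2.1 hu hv (adj_same.1 hadj).ne (adj_same.1 hadj)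
    · rcases hG a b ((adj_diff hab).1 hadj).1 with h | h
      · exact hai h
      · exact hbi h
  have hcov : ∀ G0 : SimpleGraph (Fin m), ∀ k, k ≠ i → ∀ v : W k,
      (⟨k, v⟩ : Σ i, W i) ∈ nb (rootedProduct G0 H x) (un (Function.update M i ∅)) := by
    intro G0 k hk v
    by_cases hv : v ∈ M k
    · exact ⟨⟨k, v⟩, (hmem k hk v).2 hv, Or.inl rfl⟩
    · obtain ⟨u, hu, huv⟩ := hMm k v hv
      exact ⟨⟨k, u⟩, (hmem k hk u).2 hu, Or.inr (adj_same.2 huv)⟩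
  have hlink : ∀ G0 : SimpleGraph (Fin m), (∀ a b, G0.Adj a b → a = i ∨ b = i) →
      ∀ s : Set (W i), (∀ v, (⟨i, v⟩ : Σ i, W i) ∉
        nb (rootedProduct G0 H x) (un (Function.update M i ∅)) ↔ v ∈ s) → (H i).VDOn s := by
    intro G0 hG s hs
    refine vd_of_image (emb G0 H x i)
      (link (h G0).2 (Set.toFinite _) (Set.subset_univ _) (hind G0 hG)) s ?_
    ext ⟨k, v⟩
    constructor
    · rintro ⟨-, hv⟩
      by_cases hk : k = i
      · subst hk
        exact ⟨v, (hs v).1 hv, rfl⟩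
      · exact absurd (hcov G0 k hk v) hv
    · rintro ⟨u, hu, he⟩
      cases he
      exact ⟨trivial, (hs u).2 hu⟩
  have hVD : (H i).VDOn Set.univ := by
    refine hlink ⊥ (by simp) _ fun v => ?_
    simp only [Set.mem_univ, iff_true]
    rintro ⟨⟨k, u⟩, hu, hv⟩
    have hk : k ≠ i := by rintro rfl; simp [mem_un] at hu
    rcases hv with hv | hv
    · exact hk (congrArg Sigma.fst hv).symm
    · exact absurd ((adj_diff hk).1 hv).1 (by simp)
  have hVD' : (H i).VDOn {x i}ᶜ := by
    refine hlink (SimpleGraph.edge i j) (fun a b hab => by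
      rcases hE a b hab with h | h
      · exact Or.inl h.1
      · exact Or.inr h.2) _ fun v => ?_
    constructor
    · rintro hv rfl
      exact hv ⟨⟨j, x j⟩, (hmem j (Ne.symm hij) _).2 (hM1 j),
        Or.inr ((adj_diff (Ne.symm hij)).2 ⟨hEij.symm, rfl, rfl⟩)⟩
    · rintro hvx ⟨⟨k, u⟩, hu, hv⟩
      have hk : k ≠ i := by rintro rfl; simp [mem_un] at hu
      rcases hv with hv | hv
      · exact hk (congrArg Sigma.fst hv).symm
      · exact hvx ((adj_diff hk).1 hv).2.2
  refine ⟨hVD, ⟨hVD', ?_, ?_⟩, wc_of hα, wc_of hB, ha2.trans ha1.symm⟩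
  · have := link1 hVD (x i) trivial
    rwa [← Set.compl_eq_univ_sdiff] at this
  · intro A hA
    exact max_of_card (Set.subset_univ _) hA.2.1 (by rw [hB A hA, ha1])

end back

end RP

theorem stmt4 {m : ℕ} {W : Fin m → Type*} [∀ i, Fintype (W i)]
    (H : ∀ i, SimpleGraph (W i)) (x : ∀ i, W i)
    (hstar : ∀ G0 : SimpleGraph (Fin m), ConditionStarOn G0 H x) :
    (∀ i, (H i).VertexDecomposable ∧ (H i).SheddingVertex (x i) ∧ (H i).TwoPureAt (x i)) ↔
      (∀ G0 : SimpleGraph (Fin m),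
        (rootedProduct G0 H x).WellCovered ∧ (rootedProduct G0 H x).VertexDecomposable) := by
  constructor
  · intro h G0
    exact RP.forward fun i => (h i).2
  · intro h i
    obtain ⟨hm, hcon, ⟨a, u⟩, ⟨b, v⟩, hadj⟩ := hstar ⊥
    have hab : a = b := by
      by_contra hab
      exact absurd ((RP.adj_diff hab).1 hadj).1 (by simp)
    subst hab
    have hadj' := RP.adj_same.1 hadj
    by_cases hai : a = i
    · have : Nontrivial (Fin m) := Fin.nontrivial_iff_two_le.2 hm
      obtain ⟨j, hj⟩ := exists_ne i
      exact RP.backward (Ne.symm hj) hcon ⟨a, Or.inl hai, u, v, hadj'⟩ h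
    · exact RP.backward (Ne.symm hai) hcon ⟨a, Or.inr rfl, u, v, hadj'⟩ h
end

section
/- Let G be a finite simple graph and x a vertex of G. If G−x and G−N[x] are well-covered and α(G−x) = α(G−N[x]) + 1, then G is well-covered and α(G) = α(G−x). -/
open Classical

variable {V : Type*}

theorem aux_bdd {V : Type*} [Fintype V] (G : SimpleGraph V) (s : Set V) :
    BddAbove {n : ℕ | ∃ A ⊆ s, G.IsIndepSet' A ∧ A.ncard = n} := by
  refine ⟨Nat.card V, ?_⟩
  rintro n ⟨A, -, -, rfl⟩
  exact Set.ncard_le_card A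

theorem aux_exists_max {V : Type*} [Fintype V] (G : SimpleGraph V) (s : Set V) :
    ∃ A, G.IsMaxIndepOn s A ∧ A.ncard = G.alphaOn s := by
  have hne : {n : ℕ | ∃ A ⊆ s, G.IsIndepSet' A ∧ A.ncard = n}.Nonempty :=
    ⟨0, ∅, Set.empty_subset _, Set.pairwise_empty _, Set.ncard_empty _⟩
  obtain ⟨A, hAs, hA, hn⟩ := Nat.sSup_mem hne (aux_bdd G s)
  refine ⟨A, ⟨hAs, hA, fun B hB hBi hAB => ?_⟩, hn⟩
  refine Set.eq_of_subset_of_ncard_le hAB ?_ (Set.toFinite B)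
  rw [hn]
  exact le_csSup (aux_bdd G s) ⟨B, hB, hBi, rfl⟩

theorem stmt5 {V : Type*} [Fintype V] (G : SimpleGraph V) (x : V)
    (hdel : G.WellCoveredOn {x}ᶜ)
    (hlink : G.WellCoveredOn {y | y = x ∨ G.Adj x y}ᶜ)
    (halpha : G.alphaOn {x}ᶜ = G.alphaOn {y | y = x ∨ G.Adj x y}ᶜ + 1) :
    G.WellCovered ∧ G.alphaOn Set.univ = G.alphaOn {x}ᶜ := by
  have key : ∀ A, G.IsMaxIndepOn Set.univ A → A.ncard = G.alphaOn {x}ᶜ := by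
    rintro A ⟨-, hA, hmax⟩
    by_cases hx : x ∈ A
    · have h1 : G.IsMaxIndepOn {y | y = x ∨ G.Adj x y}ᶜ (A \ {x}) := by
        refine ⟨?_, hA.mono Set.diff_subset, ?_⟩
        · rintro y ⟨hy, hyx⟩ (h | h)
          · exact hyx h
          · exact hA hx hy (fun e => hyx e.symm) h
        · intro B hB hBi hAB
          have hins : G.IsIndepSet' (insert x B) := by
            refine Set.Pairwise.insert hBi fun b hb _ => ⟨fun h => hB hb (Or.inr h),
              fun h => hB hb (Or.inr h.symm)⟩
          have hxB : x ∉ B := fun h => hB h (Or.inl rfl)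
          have := hmax _ (Set.subset_univ _) hins (by
            intro a ha
            by_cases e : a = x
            · exact Or.inl e
            · exact Or.inr (hAB ⟨ha, e⟩))
          rw [this]
          exact Set.insert_diff_self_of_notMem hxB
      rw [halpha, ← hlink _ h1]
      exact (Set.ncard_diff_singleton_add_one hx (Set.toFinite A)).symm
    · refine hdel A ⟨fun a ha e => hx (e ▸ ha), hA, fun B _ hBi hAB =>
        hmax B (Set.subset_univ _) hBi hAB⟩
  obtain ⟨A, hA, hn⟩ := aux_exists_max G Set.univ
  have heq : G.alphaOn Set.univ = G.alphaOn {x}ᶜ := hn ▸ key A hA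
  exact ⟨fun B hB => (key B hB).trans heq.symm, heq⟩
end
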